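/- arXiv:2510.20843 — 2 statements merged into one kernel-verified Lean document; each statement's English description precedes it below -/
import Mathlib

section
/- Let I ⊆ ℝ be an interval (possibly unbounded) and let f : I → ℝ be absolutely continuous on every compact subinterval of I. Then f is absolutely continuous on I if and only if its almost-everywhere derivative f' satisfies ∫_K |f'| dμ < ∞ for every Lebesgue measurable set K ⊆ I of finite Lebesgue measure. (Theorem 1 for a general interval: f ∈ AC_loc(I) with f' ∈ L¹_G(I) if and only if f ∈ AC(I).) -/
open MeasureTheory Set Filter
open scoped ENNReal

/-- `f` is absolutely continuous on the set `I`: for every `ε > 0` there is `δ > 0` such that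
for every finite collection of pairwise disjoint subintervals `(a i, b i)` of `I` with
`∑ (b i - a i) < δ` one has `∑ |f (b i) - f (a i)| < ε`. -/
def AbsolutelyContinuousOn (f : ℝ → ℝ) (I : Set ℝ) : Prop :=
  ∀ ε : ℝ, 0 < ε → ∃ δ : ℝ, 0 < δ ∧
    ∀ (n : ℕ) (a b : Fin n → ℝ),
      (∀ i, a i ∈ I ∧ b i ∈ I ∧ a i ≤ b i) →
      (Pairwise fun i j => Disjoint (Ioo (a i) (b i)) (Ioo (a j) (b j))) →
      ∑ i, (b i - a i) < δ →
      ∑ i, |f (b i) - f (a i)| < ε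

/-- If a nonnegative function has finite integral over every finite-measure measurable subset of
`I`, then its integral over measurable subsets of `I` is uniformly small on sets of small
measure. -/
lemma exists_pos_forall_setLIntegral_lt {I : Set ℝ} {φ : ℝ → ℝ≥0∞}
    (h : ∀ K : Set ℝ, K ⊆ I → MeasurableSet K → volume K < ⊤ → ∫⁻ x in K, φ x < ⊤)
    {ε : ℝ≥0∞} (hε : ε ≠ 0) :
    ∃ δ : ℝ, 0 < δ ∧ ∀ A : Set ℝ, A ⊆ I → MeasurableSet A → volume A < ENNReal.ofReal δ →
      ∫⁻ x in A, φ x < ε := by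
  by_contra! hcon
  choose A hAI hAm hAvol hAint using fun n : ℕ => hcon ((1 / 2 : ℝ) ^ n) (by positivity)
  have hU : volume (⋃ n, A n) < ⊤ := by
    refine (measure_iUnion_le A).trans_lt ?_
    refine (ENNReal.tsum_le_tsum fun n => (hAvol n).le).trans_lt ?_
    rw [← ENNReal.ofReal_tsum_of_nonneg (fun n => by positivity) summable_geometric_two]
    exact ENNReal.ofReal_lt_top
  have hfin := h _ (iUnion_subset hAI) (MeasurableSet.iUnion hAm) hU
  obtain ⟨δ, hδ, hlt⟩ := exists_pos_setLIntegral_lt_of_measure_lt hfin.ne hε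
  have htend : Tendsto (fun n : ℕ => ENNReal.ofReal ((1 / 2 : ℝ) ^ n)) atTop (nhds 0) := by
    have := ENNReal.tendsto_ofReal
      (tendsto_pow_atTop_nhds_zero_of_lt_one (r := (1 / 2 : ℝ)) (by norm_num) (by norm_num))
    simpa only [ENNReal.ofReal_zero] using this
  obtain ⟨n, hn⟩ := (htend.eventually (gt_mem_nhds hδ)).exists
  have key := hlt (A n) ((Measure.restrict_apply_le _ _).trans_lt ((hAvol n).trans hn))
  rw [Measure.restrict_restrict (hAm n), inter_eq_left.2 (subset_iUnion A n)] at key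
  exact absurd key (not_lt.2 (hAint n))

/-- If the integral of a nonnegative function is bounded uniformly over the measurable subsets of
`I` of small measure, then it is finite over every finite-measure measurable subset of `I`. -/
lemma setLIntegral_lt_top_of_forall_le {I : Set ℝ} {φ : ℝ → ℝ≥0∞} {δ : ℝ} (hδ : 0 < δ)
    {C : ℝ≥0∞} (hC : C < ⊤)
    (h : ∀ A : Set ℝ, A ⊆ I → MeasurableSet A → volume A < ENNReal.ofReal δ →
      ∫⁻ x in A, φ x ≤ C)
    {K : Set ℝ} (hKI : K ⊆ I) (hK : MeasurableSet K) (hKfin : volume K < ⊤) :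
    ∫⁻ x in K, φ x < ⊤ := by
  let P : ℤ → Set ℝ := fun k => K ∩ Ioc (k • (δ / 2)) ((k + 1) • (δ / 2))
  have hPm : ∀ k, MeasurableSet (P k) := fun k => hK.inter measurableSet_Ioc
  have hPd : Pairwise (Function.onFun Disjoint P) := fun i j hij =>
    (pairwise_disjoint_Ioc_zsmul (δ / 2) hij).mono inter_subset_right inter_subset_right
  have hPU : ⋃ k, P k = K := by
    rw [← inter_iUnion, iUnion_Ioc_zsmul (by positivity), inter_univ]
  have hsum : ∑' k, volume (P k) ≠ ⊤ := by
    rw [← measure_iUnion hPd hPm, hPU]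
    exact hKfin.ne
  obtain ⟨s, hs⟩ := ((ENNReal.tendsto_tsum_compl_atTop_zero hsum).eventually
    (gt_mem_nhds (ENNReal.ofReal_pos.2 hδ))).exists
  have hcover : K ⊆ (⋃ k : s, P k) ∪ ⋃ k : {k // k ∉ s}, P k := by
    rw [← hPU]
    refine iUnion_subset fun k x hx => ?_
    by_cases hk : k ∈ s
    · exact Or.inl (mem_iUnion.2 ⟨⟨k, hk⟩, hx⟩)
    · exact Or.inr (mem_iUnion.2 ⟨⟨k, hk⟩, hx⟩)
  refine (lintegral_mono_set hcover).trans_lt ((lintegral_union_le _ _ _).trans_lt ?_)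
  refine ENNReal.add_lt_top.2 ⟨(lintegral_iUnion_le _ _).trans_lt ?_, ?_⟩
  · rw [tsum_fintype]
    refine ENNReal.sum_lt_top.2 fun k _ => (h _ ?_ (hPm _) ?_).trans_lt hC
    · exact inter_subset_left.trans hKI
    · refine (measure_mono inter_subset_right).trans_lt ?_
      rw [Real.volume_Ioc]
      refine (ENNReal.ofReal_lt_ofReal_iff hδ).2 ?_
      simp only [zsmul_eq_mul, Int.cast_add, Int.cast_one]
      linarith
  · refine (h _ (iUnion_subset fun k => inter_subset_left.trans hKI)
      (MeasurableSet.iUnion fun k => hPm _) ?_).trans_lt hC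
    exact (measure_iUnion_le _).trans_lt hs

lemma AbsolutelyContinuousOn.absolutelyContinuousOnInterval {f : ℝ → ℝ} {a b : ℝ} (hab : a ≤ b)
    (hf : AbsolutelyContinuousOn f (Icc a b)) : AbsolutelyContinuousOnInterval f a b := by
  rw [absolutelyContinuousOnInterval_iff]
  intro ε hε
  obtain ⟨δ, hδ, H⟩ := hf ε hε
  refine ⟨δ, hδ, ?_⟩
  rintro ⟨n, E⟩ ⟨hmem, hdisj⟩ hlen
  simp only [uIcc_of_le hab, Finset.mem_range] at hmem
  have key := H n (fun i => min (E i).1 (E i).2) (fun i => max (E i).1 (E i).2) ?_ ?_ ?_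
  · rw [Finset.sum_range]
    refine lt_of_eq_of_lt (Finset.sum_congr rfl fun i _ => ?_) key
    rcases le_total (E i).1 (E i).2 with h | h
    · simp [h, Real.dist_eq, abs_sub_comm]
    · simp [h, Real.dist_eq]
  · intro i
    obtain ⟨h1, h2⟩ := hmem i i.2
    refine ⟨?_, ?_, min_le_max⟩
    · rcases min_choice (E i).1 (E i).2 with h | h <;> simpa only [h]
    · rcases max_choice (E i).1 (E i).2 with h | h <;> simpa only [h]
  · intro i j hij
    exact (hdisj (by simp) (by simp) (fun h => hij (Fin.ext h))).mono
      Ioo_subset_Ioc_self Ioo_subset_Ioc_self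
  · refine lt_of_eq_of_lt ?_ hlen
    rw [Finset.sum_range]
    refine Finset.sum_congr rfl fun i _ => ?_
    simp only [max_sub_min_eq_abs', Real.dist_eq]

/-- A compact subset of `(c, d]` lying in an open set `U` can be covered by finitely many disjoint
subintervals of `(c, d]` contained in `U`. -/
lemma IsCompact.exists_fin_Ioc_cover {K U : Set ℝ} {c d : ℝ} (hcd : c ≤ d) (hK : IsCompact K)
    (hU : IsOpen U) (hKU : K ⊆ U) (hKcd : K ⊆ Ioc c d) :
    ∃ (n : ℕ) (a b : Fin n → ℝ), (∀ i, c ≤ a i ∧ a i ≤ b i ∧ b i ≤ d) ∧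
      Pairwise (Function.onFun Disjoint fun i => Ioc (a i) (b i)) ∧
      K ⊆ ⋃ i, Ioc (a i) (b i) ∧ ⋃ i, Ioc (a i) (b i) ⊆ U := by
  classical
  obtain ⟨r, hr, hrU⟩ := hK.exists_thickening_subset_open hU hKU
  obtain ⟨N, hN⟩ := exists_nat_gt ((d - c) / r)
  have hN0 : (0 : ℝ) < N := (div_nonneg (sub_nonneg.2 hcd) hr.le).trans_lt hN
  set h : ℝ := (d - c) / N with hh
  have hh0 : 0 ≤ h := div_nonneg (sub_nonneg.2 hcd) hN0.le
  have hhr : h < r := by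
    rw [hh, div_lt_iff₀ hN0]
    rwa [div_lt_iff₀ hr, mul_comm] at hN
  have hNh : N * h = d - c := by
    rw [hh]
    field_simp
  let x : ℕ → ℝ := fun k => c + k * h
  have hx : Monotone x := fun i j hij => by
    have : (i : ℝ) ≤ j := by exact_mod_cast hij
    simp only [x]
    gcongr
  have hx0 : x 0 = c := by simp [x]
  have hxN : x N = d := by simp [x, hNh]
  have hxs : ∀ k, x (k + 1) = x k + h := fun k => by simp only [x]; push_cast; ring
  let b : Fin N → ℝ := fun i => if (Ioc (x i) (x (i + 1)) ∩ K).Nonempty then x (i + 1) else x i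
  have hble : ∀ i, b i ≤ x (i + 1) := fun i => by
    simp only [b]
    split_ifs
    · exact le_rfl
    · exact hx (Nat.le_succ _)
  refine ⟨N, fun i => x i, b, fun i => ⟨?_, ?_, ?_⟩, ?_, ?_, ?_⟩
  · exact hx0 ▸ hx (Nat.zero_le _)
  · simp only [b]
    split_ifs
    · exact hx (Nat.le_succ _)
    · exact le_rfl
  · exact (hble i).trans (hxN ▸ hx i.2)
  · intro i j hij
    exact (hx.pairwise_disjoint_on_Ioc_succ (fun h => hij (Fin.ext h))).mono
      (Ioc_subset_Ioc_right (hble i)) (Ioc_subset_Ioc_right (hble j))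
  · intro y hy
    have hy' := hKcd hy
    rw [← hx0, ← hxN, ← hx.biUnion_Ico_Ioc_map_succ 0 N] at hy'
    simp only [mem_iUnion] at hy'
    obtain ⟨i, hi, hyi⟩ := hy'
    refine mem_iUnion.2 ⟨⟨i, hi.2⟩, ?_⟩
    have hne : (Ioc (x i) (x (i + 1)) ∩ K).Nonempty := ⟨y, hyi, hy⟩
    simp only [b, if_pos hne]
    exact hyi
  · refine iUnion_subset fun i y hy => hrU ?_
    by_cases hne : (Ioc (x i) (x (i + 1)) ∩ K).Nonempty
    · simp only [b, if_pos hne] at hy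
      obtain ⟨z, hz, hzK⟩ := hne
      refine Metric.mem_thickening_iff.2 ⟨z, hzK, ?_⟩
      rw [hxs] at hz hy
      rw [Real.dist_eq, abs_lt]
      constructor <;> linarith [hz.1, hz.2, hy.1, hy.2]
    · simp only [b, if_neg hne, Ioc_self] at hy
      exact hy.elim

/-- If every finite disjoint family of subintervals of `[c, d]` of total length less than `δ` has
variation at most `C`, then `|∫ f'| ≤ C` over every measurable subset of `(c, d]` of measure less
than `δ`. -/
lemma abs_setIntegral_deriv_le {f : ℝ → ℝ} {c d δ C : ℝ} (hcd : c ≤ d)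
    (hac : AbsolutelyContinuousOnInterval f c d)
    (H : ∀ (n : ℕ) (a b : Fin n → ℝ), (∀ i, a i ∈ Icc c d ∧ b i ∈ Icc c d ∧ a i ≤ b i) →
      (Pairwise fun i j => Disjoint (Ioo (a i) (b i)) (Ioo (a j) (b j))) →
      ∑ i, (b i - a i) < δ → ∑ i, |f (b i) - f (a i)| ≤ C)
    {B : Set ℝ} (hB : MeasurableSet B) (hBcd : B ⊆ Ioc c d)
    (hBδ : volume B < ENNReal.ofReal δ) :
    |∫ x in B, deriv f x| ≤ C := by
  have hint : IntegrableOn (deriv f) (Ioc c d) :=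
    (intervalIntegrable_iff_integrableOn_Ioc_of_le hcd).1 hac.intervalIntegrable_deriv
  refine le_of_forall_pos_le_add fun η hη => ?_
  obtain ⟨δ', hδ', hsmall⟩ := exists_pos_setLIntegral_lt_of_measure_lt
    (μ := volume.restrict (Ioc c d)) (f := fun x => ‖deriv f x‖ₑ) hint.2.ne
    (ε := ENNReal.ofReal (η / 2)) (ENNReal.ofReal_pos.2 (by positivity)).ne'
  have hsmall' : ∀ S : Set ℝ, MeasurableSet S → S ⊆ Ioc c d → volume S < δ' →
      |∫ x in S, deriv f x| < η / 2 := by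
    intro S hS hScd hSδ
    have h1 := hsmall S ((Measure.restrict_apply_le _ _).trans_lt hSδ)
    rw [Measure.restrict_restrict hS, inter_eq_left.2 hScd] at h1
    have h2 := (enorm_integral_le_lintegral_enorm _).trans_lt h1
    rwa [Real.enorm_eq_ofReal_abs, ENNReal.ofReal_lt_ofReal_iff (by positivity)] at h2
  obtain ⟨K, hKB, hK, hKd⟩ := hB.exists_isCompact_sdiff_lt (hBδ.trans ENNReal.ofReal_lt_top).ne
    hδ'.ne'
  have hKδ : volume K < ENNReal.ofReal δ := (measure_mono hKB).trans_lt hBδ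
  have hε : min δ' (ENNReal.ofReal δ - volume K) ≠ 0 :=
    (lt_min hδ' (tsub_pos_of_lt hKδ)).ne'
  obtain ⟨U, hKU, hU, hUK⟩ := hK.exists_isOpen_lt_add (μ := volume) hε
  have hUδ : volume U < ENNReal.ofReal δ := by
    refine hUK.trans_le ((add_le_add_right (min_le_right _ _) _).trans ?_)
    rw [add_tsub_cancel_of_le hKδ.le]
  have hUd : volume (U \ K) < δ' := by
    rw [measure_sdiff hKU hK.measurableSet.nullMeasurableSet hK.measure_lt_top.ne]
    refine ENNReal.sub_lt_of_lt_add (measure_mono hKU) ?_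
    rw [add_comm]
    exact hUK.trans_le (add_le_add_right (min_le_left _ _) _)
  obtain ⟨n, a, b, hab, hdisj, hKE, hEU⟩ :=
    hK.exists_fin_Ioc_cover hcd hU hKU (hKB.trans hBcd)
  set E := ⋃ i, Ioc (a i) (b i) with hE
  have hEm : MeasurableSet E := MeasurableSet.iUnion fun i => measurableSet_Ioc
  have hEcd : E ⊆ Ioc c d := iUnion_subset fun i => Ioc_subset_Ioc (hab i).1 (hab i).2.2
  have hEint : ∫ x in E, deriv f x = ∑ i, (f (b i) - f (a i)) := by
    rw [hE, integral_iUnion_fintype (fun i => measurableSet_Ioc) hdisj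
      fun i => hint.mono_set (Ioc_subset_Ioc (hab i).1 (hab i).2.2)]
    refine Finset.sum_congr rfl fun i _ => ?_
    rw [← intervalIntegral.integral_of_le (hab i).2.1]
    refine (hac.mono ?_).integral_deriv_eq_sub
    rw [uIcc_of_le hcd, uIcc_of_le (hab i).2.1]
    exact Icc_subset_Icc (hab i).1 (hab i).2.2
  have hEle : |∫ x in E, deriv f x| ≤ C := by
    rw [hEint]
    refine (Finset.abs_sum_le_sum_abs _ _).trans (H n a b ?_ ?_ ?_)
    · intro i
      obtain ⟨h1, h2, h3⟩ := hab i
      exact ⟨⟨h1, h2.trans h3⟩, ⟨h1.trans h2, h3⟩, h2⟩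
    · intro i j hij
      exact (hdisj hij).mono Ioo_subset_Ioc_self Ioo_subset_Ioc_self
    · have h1 := (measure_mono hEU).trans_lt hUδ
      rw [hE, measure_iUnion hdisj fun i => measurableSet_Ioc, tsum_fintype] at h1
      simp only [Real.volume_Ioc] at h1
      rw [← ENNReal.ofReal_sum_of_nonneg fun i _ => sub_nonneg.2 (hab i).2.1] at h1
      exact (ENNReal.ofReal_lt_ofReal_iff'.1 h1).1
  have h1 := hsmall' (B \ K) (hB.diff hK.measurableSet) (sdiff_subset.trans hBcd) hKd
  have h2 := hsmall' (E \ K) (hEm.diff hK.measurableSet) (sdiff_subset.trans hEcd)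
    ((measure_mono (sdiff_subset_sdiff_left hEU)).trans_lt hUd)
  rw [setIntegral_sdiff hK.measurableSet (hint.mono_set hBcd) hKB] at h1
  rw [setIntegral_sdiff hK.measurableSet (hint.mono_set hEcd) hKE] at h2
  rw [abs_lt] at h1 h2
  rw [abs_le] at hEle ⊢
  constructor <;> linarith [h1.1, h1.2, h2.1, h2.2, hEle.1, hEle.2]

/-- If `|∫ g| ≤ C` over every measurable subset of `A`, then `∫ |g| ≤ 2 C` over `A`. -/
lemma setLIntegral_enorm_le_of_abs_setIntegral_le {g : ℝ → ℝ} (hg : Measurable g) {A : Set ℝ}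
    (hA : MeasurableSet A) (hint : IntegrableOn g A) {C : ℝ}
    (h : ∀ B ⊆ A, MeasurableSet B → |∫ x in B, g x| ≤ C) :
    ∫⁻ x in A, ‖g x‖ₑ ≤ ENNReal.ofReal (2 * C) := by
  have hS : MeasurableSet {x | 0 ≤ g x} := measurableSet_le measurable_const hg
  rw [← ofReal_integral_norm_eq_lintegral_enorm hint]
  refine ENNReal.ofReal_le_ofReal ?_
  rw [← integral_inter_add_sdiff hS hint.norm]
  have h1 : ∫ x in A ∩ {x | 0 ≤ g x}, ‖g x‖ = ∫ x in A ∩ {x | 0 ≤ g x}, g x :=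
    setIntegral_congr_fun (hA.inter hS) fun x hx => Real.norm_of_nonneg hx.2
  have h2 : ∫ x in A \ {x | 0 ≤ g x}, ‖g x‖ = -∫ x in A \ {x | 0 ≤ g x}, g x := by
    rw [← integral_neg]
    exact setIntegral_congr_fun (hA.diff hS) fun x hx =>
      Real.norm_of_nonpos (not_le.1 hx.2).le
  rw [h1, h2]
  linarith [(abs_le.1 (h _ inter_subset_left (hA.inter hS))).2,
    (abs_le.1 (h _ sdiff_subset (hA.diff hS))).1]

lemma OrdConnected.ae_mem_interior {I : Set ℝ} (hI : I.OrdConnected) :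
    ∀ᵐ x : ℝ, x ∈ I → x ∈ interior I := by
  have h := hI.convex.addHaar_frontier volume
  filter_upwards [measure_eq_zero_iff_ae_notMem.1 h] with x hx hxI
  by_contra hxi
  exact hx ⟨subset_closure hxI, hxi⟩

/-- To bound the integral of a nonnegative function over subsets of an interval `I`, it suffices to
do so over subsets of compact subintervals of `I`. -/
lemma setLIntegral_le_of_forall_inter_Ioc {I : Set ℝ} (hI : I.OrdConnected) {φ : ℝ → ℝ≥0∞}
    {A : Set ℝ} (hA : A ⊆ I) {C : ℝ≥0∞}
    (h : ∀ c ∈ I, ∀ d ∈ I, ∫⁻ x in A ∩ Ioc c d, φ x ≤ C) :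
    ∫⁻ x in A, φ x ≤ C := by
  let ι := {p : ℚ × ℚ // (p.1 : ℝ) ∈ I ∧ (p.2 : ℝ) ∈ I}
  let S : ι → Set ℝ := fun p => A ∩ Ioc (p.1.1 : ℝ) (p.1.2 : ℝ)
  have hdir : Directed (· ⊆ ·) S := by
    rintro ⟨⟨p, q⟩, hp, hq⟩ ⟨⟨p', q'⟩, hp', hq'⟩
    refine ⟨⟨(min p p', max q q'), ?_, ?_⟩, ?_, ?_⟩
    · rcases min_choice p p' with h | h <;> simpa only [h]
    · rcases max_choice q q' with h | h <;> simpa only [h]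
    · refine inter_subset_inter_right _ (Ioc_subset_Ioc ?_ ?_)
      · exact_mod_cast min_le_left p p'
      · exact_mod_cast le_max_left q q'
    · refine inter_subset_inter_right _ (Ioc_subset_Ioc ?_ ?_)
      · exact_mod_cast min_le_right p p'
      · exact_mod_cast le_max_right q q'
  have hAS : A ≤ᵐ[volume] ⋃ p, S p := by
    filter_upwards [OrdConnected.ae_mem_interior hI] with x hx hxA
    have hnhds := mem_interior_iff_mem_nhds.1 (hx (hA hxA))
    obtain ⟨l, u, hxlu, hlu⟩ := mem_nhds_iff_exists_Ioo_subset.1 hnhds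
    obtain ⟨p, hp, hpx⟩ := exists_rat_btwn hxlu.1
    obtain ⟨q, hxq, hq⟩ := exists_rat_btwn hxlu.2
    exact mem_iUnion.2 ⟨⟨(p, q), hlu ⟨hp, hpx.trans hxlu.2⟩, hlu ⟨hxlu.1.trans hxq, hq⟩⟩,
      hxA, hpx, hxq.le⟩
  calc ∫⁻ x in A, φ x ≤ ∫⁻ x in ⋃ p, S p, φ x :=
        lintegral_mono' (Measure.restrict_mono' hAS le_rfl) le_rfl
    _ = ⨆ p, ∫⁻ x in S p, φ x := setLIntegral_iUnion_of_directed _ hdir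
    _ ≤ C := iSup_le fun p => h _ p.2.1 _ p.2.2

lemma setLIntegral_derivWithin_eq {I : Set ℝ} (hI : I.OrdConnected) (f : ℝ → ℝ) {K : Set ℝ}
    (hKI : K ⊆ I) (hK : MeasurableSet K) :
    ∫⁻ x in K, ‖derivWithin f I x‖₊ = ∫⁻ x in K, ‖deriv f x‖ₑ := by
  refine setLIntegral_congr_fun_ae hK ?_
  filter_upwards [OrdConnected.ae_mem_interior hI] with x hx hxK
  rw [derivWithin_of_mem_nhds (mem_interior_iff_mem_nhds.1 (hx (hKI hxK)))]
  rfl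

/-- Theorem 1 for a general interval `I ⊆ ℝ`: if `f` is absolutely continuous on every compact
subinterval of `I`, then `f` is absolutely continuous on `I` iff its a.e. derivative is
integrable over every measurable subset of `I` of finite Lebesgue measure. -/
theorem theorem1_interval
    (I : Set ℝ) (hI : I.OrdConnected)
    (f : ℝ → ℝ)
    (hloc : ∀ a b : ℝ, Icc a b ⊆ I → AbsolutelyContinuousOn f (Icc a b)) :
    AbsolutelyContinuousOn f I ↔
      (∀ K : Set ℝ, K ⊆ I → MeasurableSet K → volume K < ⊤ →
        ∫⁻ x in K, ‖derivWithin f I x‖₊ ∂volume < ⊤) := by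
  have hderiv : (∀ K : Set ℝ, K ⊆ I → MeasurableSet K → volume K < ⊤ →
        ∫⁻ x in K, ‖derivWithin f I x‖₊ ∂volume < ⊤) ↔
      (∀ K : Set ℝ, K ⊆ I → MeasurableSet K → volume K < ⊤ →
        ∫⁻ x in K, ‖deriv f x‖ₑ < ⊤) :=
    forall₃_congr fun K hKI hK => by rw [setLIntegral_derivWithin_eq hI f hKI hK]
  have hac : ∀ a ∈ I, ∀ b ∈ I, a ≤ b → AbsolutelyContinuousOnInterval f a b :=
    fun a ha b hb hab => (hloc a b (hI.out ha hb)).absolutelyContinuousOnInterval hab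
  rw [hderiv]
  constructor
  · intro hf K hKI hK hKfin
    obtain ⟨δ, hδ, H⟩ := hf 1 one_pos
    refine setLIntegral_lt_top_of_forall_le hδ (ENNReal.ofReal_lt_top (r := 2 * 1)) ?_
      hKI hK hKfin
    intro A hAI hA hAδ
    refine setLIntegral_le_of_forall_inter_Ioc hI hAI fun c hc d hd => ?_
    rcases le_total d c with hdc | hcd
    · simp [Ioc_eq_empty_of_le hdc]
    have hint : IntegrableOn (deriv f) (Ioc c d) :=
      (intervalIntegrable_iff_integrableOn_Ioc_of_le hcd).1
        (hac c hc d hd hcd).intervalIntegrable_deriv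
    refine setLIntegral_enorm_le_of_abs_setIntegral_le (measurable_deriv f)
      (hA.inter measurableSet_Ioc) (hint.mono_set inter_subset_right) fun B hBA hB => ?_
    refine abs_setIntegral_deriv_le hcd (hac c hc d hd hcd) ?_ hB
      (hBA.trans inter_subset_right)
      ((measure_mono (hBA.trans inter_subset_left)).trans_lt hAδ)
    intro n a b hab hdisj hlen
    exact (H n a b (fun i => ⟨hI.out hc hd (hab i).1, hI.out hc hd (hab i).2.1, (hab i).2.2⟩)
      hdisj hlen).le
  · intro h ε hε
    obtain ⟨δ, hδ, H⟩ := exists_pos_forall_setLIntegral_lt h (ENNReal.ofReal_pos.2 hε).ne'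
    refine ⟨δ, hδ, fun n a b hab hdisj hlen => ?_⟩
    have hnonneg : ∀ i, 0 ≤ b i - a i := fun i => sub_nonneg.2 (hab i).2.2
    have hle : ∀ i, ENNReal.ofReal |f (b i) - f (a i)| ≤
        ∫⁻ x in Ioo (a i) (b i), ‖deriv f x‖ₑ := by
      intro i
      obtain ⟨ha, hb, hle⟩ := hab i
      rw [← (hac _ ha _ hb hle).integral_deriv_eq_sub, intervalIntegral.integral_of_le hle,
        ← Real.enorm_eq_ofReal_abs, integral_Ioc_eq_integral_Ioo]
      exact enorm_integral_le_lintegral_enorm _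
    have hvol : volume (⋃ i, Ioo (a i) (b i)) < ENNReal.ofReal δ := by
      rw [measure_iUnion hdisj fun i => measurableSet_Ioo, tsum_fintype]
      simp only [Real.volume_Ioo]
      rw [← ENNReal.ofReal_sum_of_nonneg fun i _ => hnonneg i]
      exact (ENNReal.ofReal_lt_ofReal_iff hδ).2 hlen
    have hlt := H _ (iUnion_subset fun i => Ioo_subset_Icc_self.trans
      (hI.out (hab i).1 (hab i).2.1)) (MeasurableSet.iUnion fun i => measurableSet_Ioo) hvol
    rw [lintegral_iUnion (fun i => measurableSet_Ioo) hdisj, tsum_fintype] at hlt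
    have hsum := (Finset.sum_le_sum fun i (_ : i ∈ Finset.univ) => hle i).trans_lt hlt
    rw [← ENNReal.ofReal_sum_of_nonneg fun i _ => abs_nonneg _] at hsum
    exact (ENNReal.ofReal_lt_ofReal_iff hε).1 hsum
end

section
/- Let f : ℝ → ℝ be the 2-periodic function determined by f(x) = √|x| for −1 ≤ x ≤ 1 and f(x + 2k) = f(x) for all k ∈ ℤ, and let f' denote its almost-everywhere derivative. Then for every r > 0, the set {x ∈ ℝ : |f'(x)| > r} has infinite Lebesgue measure; hence f' ∉ L¹_H(ℝ). -/
open MeasureTheory Set Filter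
open scoped ENNReal

/-- The union of the intervals of length `δ ≤ 2` starting at the even naturals has infinite
measure. -/
theorem volume_iUnion_Ioo_even_eq_top {δ : ℝ} (hδ : 0 < δ) (hδ2 : δ ≤ 2) :
    volume (⋃ n : ℕ, Ioo (2 * n : ℝ) (2 * n + δ)) = ⊤ := by
  have hdisj : Pairwise fun m n : ℕ =>
      Disjoint (Ioo (2 * m : ℝ) (2 * m + δ)) (Ioo (2 * n : ℝ) (2 * n + δ)) := by
    refine (pairwise_disjoint_on fun n : ℕ => Ioo (2 * n : ℝ) (2 * n + δ)).2 fun m n hmn => ?_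
    have h : (m : ℝ) + 1 ≤ n := by exact_mod_cast hmn
    refine Set.disjoint_left.2 fun x hx hy => ?_
    linarith [hx.2, hy.1]
  rw [measure_iUnion hdisj fun _ => measurableSet_Ioo]
  simp only [Real.volume_Ioo, add_sub_cancel_left]
  exact ENNReal.tsum_const_eq_top_of_ne_zero (by simpa using hδ)

theorem hasDerivAt_periodic_sqrt {f : ℝ → ℝ}
    (hf : ∀ x ∈ Icc (-1 : ℝ) 1, f x = Real.sqrt |x|)
    (hper : ∀ (x : ℝ) (k : ℤ), f (x + 2 * k) = f x) (n : ℤ) {x : ℝ}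
    (hx : x ∈ Ioo (2 * n : ℝ) (2 * n + 1)) :
    HasDerivAt f (1 / (2 * Real.sqrt (x - 2 * n))) x := by
  have hpos : 0 < x - 2 * n := sub_pos.2 hx.1
  refine (((hasDerivAt_id x).sub_const (2 * n : ℝ)).sqrt hpos.ne').congr_of_eventuallyEq ?_
  filter_upwards [Ioo_mem_nhds hx.1 hx.2] with y hy
  have hy0 : 0 < y - 2 * n := sub_pos.2 hy.1
  rw [← hper y (-n), hf]
  · push_cast
    rw [show y + 2 * -(n : ℝ) = y - 2 * n by ring, abs_of_pos hy0]
    rfl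
  · push_cast
    exact ⟨by linarith, by linarith [hy.2]⟩

/-- For the 2-periodic function given by `f x = √|x|` on `[-1, 1]`, for every `r > 0` the set
`{x | |f' x| > r}` has infinite Lebesgue measure; hence `f' ∉ L¹_H(ℝ)`. -/
theorem periodic_sqrt_deriv_not_L1H
    (f : ℝ → ℝ)
    (hf : ∀ x ∈ Icc (-1 : ℝ) 1, f x = Real.sqrt |x|)
    (hper : ∀ (x : ℝ) (k : ℤ), f (x + 2 * k) = f x) :
    (∀ r : ℝ, 0 < r → volume {x : ℝ | r < |deriv f x|} = ⊤) ∧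
    ¬ ∃ M : ℝ, 0 < M ∧ volume {x : ℝ | M ≤ |deriv f x|} < ⊤ := by
  have htop : ∀ r : ℝ, 0 < r → volume {x : ℝ | r < |deriv f x|} = ⊤ := by
    intro r hr
    have hδ : 0 < min 1 ((1 / (2 * r)) ^ 2) := by positivity
    refine measure_mono_top ?_
      (volume_iUnion_Ioo_even_eq_top hδ ((min_le_left _ _).trans one_le_two))
    refine iUnion_subset fun n x hx => ?_
    have hpos : 0 < x - 2 * n := sub_pos.2 hx.1
    have h1 : x < 2 * n + 1 := hx.2.trans_le (by gcongr; exact min_le_left _ _)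
    have h2 : x - 2 * n < (1 / (2 * r)) ^ 2 :=
      (sub_lt_iff_lt_add'.2 hx.2).trans_le (min_le_right _ _)
    have hd := hasDerivAt_periodic_sqrt hf hper n (x := x) (by simpa using ⟨hx.1, h1⟩)
    rw [Int.cast_natCast] at hd
    have hs : 0 < Real.sqrt (x - 2 * n) := Real.sqrt_pos.2 hpos
    have hlt : Real.sqrt (x - 2 * n) < 1 / (2 * r) := (Real.sqrt_lt' (by positivity)).2 h2
    rw [mem_ofPred_eq, hd.deriv, abs_of_pos (by positivity), lt_div_iff₀ (by positivity)]
    rw [lt_div_iff₀ (by positivity)] at hlt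
    linarith
  refine ⟨htop, ?_⟩
  rintro ⟨M, hM, hfin⟩
  have hsub : {x : ℝ | M < |deriv f x|} ⊆ {x | M ≤ |deriv f x|} := by
    intro x hx
    rw [mem_ofPred_eq] at hx ⊢
    exact hx.le
  exact hfin.ne (measure_mono_top hsub (htop M hM))
end
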